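/- Fix an integer m ≥ 1 and n with 2 ≤ n ≤ ∞, and let Γ and the cost function c be as in the context. Then any directed path in Γ from the vertex −(2m+1) to the vertex −1 all of whose other vertices are a-vertices has cost at least 1 − 1/n. Likewise, any directed path in Γ from the vertex 1 to the vertex 2m+1 all of whose other vertices are a-vertices has cost at least 1 − 1/n. -/

import Mathlib

/-- The vertex set `V = {i ∈ ℤ : 1 ≤ |i| ≤ 2m+1}`. -/
def memV (m i : ℤ) : Prop := 1 ≤ |i| ∧ |i| ≤ 2 * m + 1

/-- `i` is an `a`-vertex: `|i|` odd and `|i| ≤ 2m - 1`. -/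
def isA (m i : ℤ) : Prop := Odd |i| ∧ |i| ≤ 2 * m - 1

/-- `i` is a `b`-vertex: `|i|` even. -/
def isB (i : ℤ) : Prop := Even i

/-- The start-side of a vertex: `true` = `P`, `false` = `N`. -/
def startSide (m i : ℤ) : Bool :=
  if i = 2 * m + 1 then true
  else if i = -(2 * m + 1) then false
  else if i % 2 = 0 then false else true

/-- The end-side of a vertex: `true` = `P`, `false` = `N`. -/
def endSide (m i : ℤ) : Bool :=
  if i = 2 * m + 1 then false
  else if i = -(2 * m + 1) then true
  else if i % 2 = 0 then false else true

/-- `(u, v)` is a directed edge of `Γ`: both are vertices and the end-side of `u`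
equals the start-side of `v`. -/
def isEdge (m u v : ℤ) : Prop := memV m u ∧ memV m v ∧ endSide m u = startSide m v

/-- The real number `1/n` for `n : ℕ∞`, with the convention `1/∞ = 0`. -/
noncomputable def invE (n : ℕ∞) : ℝ := ((n.toNat : ℝ))⁻¹

/-- The cost function `c` on ordered pairs of vertices:
for `1 ≤ i, j ≤ 2m+1`, `c(i,j) = 1 - 1/n` if `i < j`, `1/n` if `j ≤ i < 2m+1`, `0` if
`i = 2m+1`; `c(i,-j) = 0` if `i = 2m+1` or `j = 2m+1` or `i = j = 2m`, else `1 - 1/n`;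
`c(-i,j) = 1` if `i = j = 2m+1`, `2/n - 1` if `i = j = 1`, else `1/n`;
`c(-i,-j) = 1 - 1/n` if `i > j`, `1/n` if `i ≤ j < 2m+1`, `0` if `j = 2m+1`. -/
noncomputable def cost (m : ℤ) (n : ℕ∞) (u v : ℤ) : ℝ :=
  if 0 < u then
    if 0 < v then
      if u = 2 * m + 1 then 0
      else if u < v then 1 - invE n
      else invE n
    else
      if u = 2 * m + 1 ∨ v = -(2 * m + 1) ∨ (u = 2 * m ∧ v = -(2 * m)) then 0
      else 1 - invE n
  else
    if 0 < v then
      if u = -(2 * m + 1) ∧ v = 2 * m + 1 then 1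
      else if u = -1 ∧ v = 1 then 2 * invE n - 1
      else invE n
    else
      if v = -(2 * m + 1) then 0
      else if u < v then 1 - invE n
      else invE n

theorem invE_bounds (n : ℕ∞) (hn : 2 ≤ n) : 0 ≤ invE n ∧ 2 * invE n ≤ 1 := by
  unfold invE
  refine ⟨by positivity, ?_⟩
  induction n using ENat.recTopCoe with
  | top => simp
  | coe k =>
    have hk : 2 ≤ k := by exact_mod_cast hn
    have hk' : (2 : ℝ) ≤ k := by exact_mod_cast hk
    simp only [ENat.toNat_coe]
    rw [← div_eq_mul_inv, div_le_one (by linarith)]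
    exact hk'

theorem potential_bound (g : ℤ → ℝ) (c : ℤ → ℤ → ℝ) (v : ℕ → ℤ) (L : ℕ)
    (h : ∀ i < L, g (v (i + 1)) - g (v i) ≤ c (v i) (v (i + 1))) :
    g (v L) - g (v 0) ≤ ∑ i ∈ Finset.range L, c (v i) (v (i + 1)) := by
  rw [← Finset.sum_range_sub (fun i => g (v i)) L]
  exact Finset.sum_le_sum fun i hi => h i (Finset.mem_range.mp hi)

/-- Any directed path in `Γ` from `-(2m+1)` to `-1` all of whose other vertices are
`a`-vertices has cost at least `1 - 1/n`; likewise for paths from `1` to `2m+1` all of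
whose other vertices are `a`-vertices. -/
theorem stmt17 (m : ℤ) (hm : 1 ≤ m) (n : ℕ∞) (hn : 2 ≤ n) :
    (∀ (L : ℕ) (v : ℕ → ℤ), v 0 = -(2 * m + 1) → v L = -1 →
      (∀ i < L, isEdge m (v i) (v (i + 1))) →
      (∀ i, 1 ≤ i → i ≤ L → isA m (v i)) →
      1 - invE n ≤ ∑ i ∈ Finset.range L, cost m n (v i) (v (i + 1))) ∧
    (∀ (L : ℕ) (v : ℕ → ℤ), v 0 = 1 → v L = 2 * m + 1 →
      (∀ i < L, isEdge m (v i) (v (i + 1))) →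
      (∀ i < L, isA m (v i)) →
      1 - invE n ≤ ∑ i ∈ Finset.range L, cost m n (v i) (v (i + 1))) := by
  obtain ⟨h0, h1⟩ := invE_bounds n hn
  constructor
  · intro L v hv0 hvL _ hA
    have key := potential_bound
      (fun w => if w = -(2 * m + 1) then 0 else if 0 < w then invE n else 1 - invE n)
      (cost m n) v L ?_
    · have e1 : ¬ ((-1 : ℤ) = -(2 * m + 1)) := by omega
      simp only [hv0, hvL, if_neg e1] at key
      norm_num at key
      linarith
    · intro i hi
      have hb := (hA (i + 1) (by omega) (by omega)).2
      have ha : v i = -(2 * m + 1) ∨ |v i| ≤ 2 * m - 1 := by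
        rcases Nat.eq_zero_or_pos i with rfl | hp
        · exact Or.inl hv0
        · exact Or.inr (hA i hp hi.le).2
      generalize v i = a at *
      generalize v (i + 1) = b at *
      rw [abs_le] at hb ha
      unfold cost
      split_ifs <;> first | (exfalso; omega) | linarith
  · intro L v hv0 hvL _ hA
    have key := potential_bound
      (fun w => if w = 2 * m + 1 then 1 - invE n else if 0 < w then 0 else 1 - invE n)
      (cost m n) v L ?_
    · have e1 : ¬ ((1 : ℤ) = 2 * m + 1) := by omega
      simp only [hv0, hvL, if_neg e1] at key
      norm_num at key
      linarith
    · intro i hi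
      have ha := (hA i hi).2
      have hb : v (i + 1) = 2 * m + 1 ∨ |v (i + 1)| ≤ 2 * m - 1 := by
        rcases Nat.lt_or_ge (i + 1) L with hp | hp
        · exact Or.inr (hA _ hp).2
        · left
          have : i + 1 = L := by omega
          rw [this, hvL]
      generalize v i = a at *
      generalize v (i + 1) = b at *
      rw [abs_le] at hb ha
      unfold cost
      split_ifs <;> first | (exfalso; omega) | linarith
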